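/- arXiv:0903.3607 — 8 statements merged into one kernel-verified Lean document; each statement's English description precedes it below -/
import Mathlib

section
/- Let B ≠ 0 and β > 0 be real constants, let h : ℝ³ → ℝ satisfy |h(A,x,y)| ≤ β(1+|x|) for all (A,x,y), and define F : ℝ × ℝ² → ℝ² by F(A,x,y) = (A + B·y − x² + h(A,x,y), x). Set ρ = (|B| + β + 1)/2. If for some parameter A the map F(A,·) has a periodic point p (i.e. the k-th iterate of F(A,·) fixes p for some k ≥ 1), then A + β + ρ² ≥ 0, and every point (x,y) on the orbit of p satisfies |x| ≤ ρ + √(A + β + ρ²) and |y| ≤ ρ + √(A + β + ρ²). In particular, if A < −(β + ρ²) then F(A,·) has no periodic points. -/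
/-- A real-valued function attains its maximum along a periodic orbit. -/
theorem Function.IsPeriodicPt.exists_forall_iterate_le {α : Type*} {f : α → α} {p : α} {k : ℕ}
    (hp : Function.IsPeriodicPt f k p) (hk : 0 < k) (g : α → ℝ) :
    ∃ m, ∀ n, g (f^[n] p) ≤ g (f^[m] p) := by
  obtain ⟨m, -, hm⟩ := Finset.exists_max_image (Finset.range k) (fun n => g (f^[n] p))
    ⟨0, Finset.mem_range.2 hk⟩
  refine ⟨m, fun n => ?_⟩
  rw [← hp.iterate_mod_apply n]
  exact hm _ (Finset.mem_range.2 (Nat.mod_lt n hk))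

/-- Bounds on periodic orbits of a perturbed Hénon family, and
nonexistence of periodic points for very negative parameters. -/
theorem perturbed_henon_periodic_orbit_bound
    (B β : ℝ) (hB : B ≠ 0) (hβ : 0 < β)
    (h : ℝ → ℝ → ℝ → ℝ)
    (hh : ∀ A x y : ℝ, |h A x y| ≤ β * (1 + |x|))
    (F : ℝ → ℝ × ℝ → ℝ × ℝ)
    (hF : ∀ A : ℝ, ∀ x y : ℝ, F A (x, y) = (A + B * y - x ^ 2 + h A x y, x))
    (ρ : ℝ) (hρ : ρ = (|B| + β + 1) / 2) :
    (∀ (A : ℝ) (p : ℝ × ℝ) (k : ℕ), 1 ≤ k → (F A)^[k] p = p →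
      0 ≤ A + β + ρ ^ 2 ∧
      ∀ n : ℕ,
        |((F A)^[n] p).1| ≤ ρ + Real.sqrt (A + β + ρ ^ 2) ∧
        |((F A)^[n] p).2| ≤ ρ + Real.sqrt (A + β + ρ ^ 2)) ∧
    (∀ A : ℝ, A < -(β + ρ ^ 2) →
      ∀ (p : ℝ × ℝ) (k : ℕ), 1 ≤ k → (F A)^[k] p ≠ p) := by
  have key : ∀ (A : ℝ) (p : ℝ × ℝ) (k : ℕ), 1 ≤ k → (F A)^[k] p = p →
      0 ≤ A + β + ρ ^ 2 ∧
      ∀ n : ℕ,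
        |((F A)^[n] p).1| ≤ ρ + Real.sqrt (A + β + ρ ^ 2) ∧
        |((F A)^[n] p).2| ≤ ρ + Real.sqrt (A + β + ρ ^ 2) := by
    intro A p k hk hp
    have hF' : ∀ q : ℝ × ℝ, F A q = (A + B * q.2 - q.1 ^ 2 + h A q.1 q.2, q.1) :=
      fun q => hF A q.1 q.2
    have hper : Function.IsPeriodicPt (F A) k p := hp
    obtain ⟨m, hm⟩ := hper.exists_forall_iterate_le hk fun q => |q.1|
    have hsnd : ∀ n, ((F A)^[n] p).2 = ((F A)^[n + (k - 1)] p).1 := by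
      intro n
      have hshift : (F A)^[n] p = F A ((F A)^[n + (k - 1)] p) := by
        rw [← Function.iterate_succ_apply' (F A), show (n + (k - 1)).succ = n + k by omega,
          Function.iterate_add_apply, hp]
      rw [hshift, hF']
    have hsnd_le : ∀ n, |((F A)^[n] p).2| ≤ |((F A)^[m] p).1| := by
      intro n
      rw [hsnd]
      exact hm _
    have hnext := hm (m + 1)
    have hy := hsnd_le m
    rw [Function.iterate_succ_apply', hF'] at hnext
    generalize (F A)^[m] p = q at hm hsnd_le hnext hy
    have hBy : B * q.2 ≤ |B| * |q.1| :=
      (le_abs_self _).trans (abs_mul B q.2 ▸ mul_le_mul_of_nonneg_left hy (abs_nonneg B))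
    have hsq : (|q.1| - ρ) ^ 2 ≤ A + β + ρ ^ 2 := by
      have hlow := (abs_le.1 hnext).1
      have hpert := (le_abs_self _).trans (hh A q.1 q.2)
      have habs := sq_abs q.1
      have hlin : 2 * ρ * |q.1| = |B| * |q.1| + β * |q.1| + |q.1| := by rw [hρ]; ring
      nlinarith
    have hmax : |q.1| ≤ ρ + Real.sqrt (A + β + ρ ^ 2) := by
      linarith [Real.le_sqrt_of_sq_le hsq]
    exact ⟨(sq_nonneg _).trans hsq, fun n => ⟨(hm n).trans hmax, (hsnd_le n).trans hmax⟩⟩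
  refine ⟨key, fun A hA p k hk hp => ?_⟩
  linarith [(key A p k hk hp).1]
end

section
/- Let B ≠ 0 and β > 0 be real constants, let h : ℝ³ → ℝ satisfy |h(A,x,y)| ≤ β(1+|x|) for all (A,x,y), and define F(A,x,y) = (A + B·y − x² + h(A,x,y), x). Set ρ = (|B| + β + 1)/2. Suppose A₁ > 0 satisfies ρ + √(A₁ + β + ρ²) < 2√A₁, and set Q = 2√A₁. Then for every A ≤ A₁, every periodic orbit of F(A,·) is contained in the open square (−Q, Q) × (−Q, Q), i.e. in the interior of E = [−Q,Q] × [−Q,Q]. -/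
/-- For all parameters `A ≤ A₁`, every periodic orbit of the
perturbed Hénon map lies in the interior of the square `E = [−Q,Q] × [−Q,Q]`,
where `Q = 2√A₁`. -/
theorem perturbed_henon_periodic_orbits_in_interior
    (B β : ℝ) (hB : B ≠ 0) (hβ : 0 < β)
    (h : ℝ → ℝ → ℝ → ℝ)
    (hh : ∀ A x y : ℝ, |h A x y| ≤ β * (1 + |x|))
    (F : ℝ → ℝ × ℝ → ℝ × ℝ)
    (hF : ∀ A : ℝ, ∀ x y : ℝ, F A (x, y) = (A + B * y - x ^ 2 + h A x y, x))
    (ρ : ℝ) (hρ : ρ = (|B| + β + 1) / 2)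
    (A₁ : ℝ) (hA₁ : 0 < A₁)
    (hgap : ρ + Real.sqrt (A₁ + β + ρ ^ 2) < 2 * Real.sqrt A₁)
    (Q : ℝ) (hQ : Q = 2 * Real.sqrt A₁) :
    ∀ A : ℝ, A ≤ A₁ →
      ∀ (p : ℝ × ℝ) (k : ℕ), 1 ≤ k → (F A)^[k] p = p →
        ∀ n : ℕ, (F A)^[n] p ∈ Set.Ioo (-Q) Q ×ˢ Set.Ioo (-Q) Q := by
  intro A hA p k hk hp
  have hper : ∀ n, (F A)^[n + k] p = (F A)^[n] p := fun n => by
    rw [Function.iterate_add_apply, hp]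
  have hfst : ∀ n, ((F A)^[n + 1] p).1 = A + B * ((F A)^[n] p).2 - ((F A)^[n] p).1 ^ 2
      + h A ((F A)^[n] p).1 ((F A)^[n] p).2 := fun n => by
    rw [Function.iterate_succ_apply']
    exact congrArg Prod.fst (hF A _ _)
  have hsnd : ∀ n, ((F A)^[n + 1] p).2 = ((F A)^[n] p).1 := fun n => by
    rw [Function.iterate_succ_apply']
    exact congrArg Prod.snd (hF A _ _)
  have hprev : ∀ n, ((F A)^[n] p).2 = ((F A)^[n + (k - 1)] p).1 := fun n => by
    rw [← hsnd, show n + (k - 1) + 1 = n + k by omega, hper]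
  obtain ⟨m, -, hmax⟩ := Finset.exists_max_image (Finset.range k)
    (fun n => |((F A)^[n] p).1|) ⟨0, Finset.mem_range.2 hk⟩
  have hM : ∀ n, |((F A)^[n] p).1| ≤ |((F A)^[m] p).1| := fun n => by
    have hmod : (F A)^[n % k] p = (F A)^[n] p :=
      Function.IsPeriodicPt.iterate_mod_apply hp n
    rw [← hmod]
    exact hmax _ (Finset.mem_range.2 (Nat.mod_lt _ hk))
  have hlt : |((F A)^[m] p).1| < Q := by
    have hnext := (abs_le.1 (hM (m + 1))).1
    have hback : |((F A)^[m] p).2| ≤ |((F A)^[m] p).1| := hprev m ▸ hM _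
    have hpert := (abs_le.1 (hh A ((F A)^[m] p).1 ((F A)^[m] p).2)).2
    have hlin : B * ((F A)^[m] p).2 ≤ |B| * |((F A)^[m] p).1| :=
      ((le_abs_self _).trans_eq (abs_mul B _)).trans
        (mul_le_mul_of_nonneg_left hback (abs_nonneg B))
    rw [hfst] at hnext
    have hsq := sq_abs ((F A)^[m] p).1
    have hquad : (|((F A)^[m] p).1| - ρ) ^ 2 ≤ A₁ + β + ρ ^ 2 := by
      subst hρ
      linarith
    have := Real.le_sqrt_of_sq_le hquad
    linarith
  intro n
  refine ⟨abs_lt.1 ((hM n).trans_lt hlt), ?_⟩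
  rw [hprev]
  exact abs_lt.1 ((hM _).trans_lt hlt)
end

section
/- Let B ≠ 0 and β > 0 be real constants, let h : ℝ³ → ℝ satisfy |h(A,x,y)| ≤ β(1+|x|) for all (A,x,y), and define F(A,x,y) = (A + B·y − x² + h(A,x,y), x). There exists A* > 0, depending only on β and |B|, such that for every A₁ ≥ A*, setting s = √A₁, Q = 2s and E = [−Q,Q] × [−Q,Q]: for every (x,y) ∈ E with |x| < s/2, the first coordinate of F(A₁,x,y) is strictly greater than Q; in particular F(A₁,x,y) ∉ E. (Thus F(A₁, ·) maps the set E ∖ (J × L), where J = [−2s,−s/2] ∪ [s/2,2s] and L = [−Q,Q], entirely outside of E.) -/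
/-- For sufficiently large `A₁` (depending only on `β` and `|B|`),
points of `E = [−Q,Q]²` with `|x| < s/2` are mapped by `F(A₁,·)` to points whose
first coordinate exceeds `Q`; in particular such points leave `E`. -/
theorem perturbed_henon_escape_outside_J
    (B β : ℝ) (hB : B ≠ 0) (hβ : 0 < β) :
    ∃ Astar : ℝ, 0 < Astar ∧
      ∀ h : ℝ → ℝ → ℝ → ℝ, (∀ A x y : ℝ, |h A x y| ≤ β * (1 + |x|)) →
        ∀ A₁ : ℝ, Astar ≤ A₁ →
          ∀ x y : ℝ,
            (x, y) ∈ Set.Icc (-(2 * Real.sqrt A₁)) (2 * Real.sqrt A₁) ×ˢ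
              Set.Icc (-(2 * Real.sqrt A₁)) (2 * Real.sqrt A₁) →
            |x| < Real.sqrt A₁ / 2 →
              2 * Real.sqrt A₁ < A₁ + B * y - x ^ 2 + h A₁ x y ∧
              (A₁ + B * y - x ^ 2 + h A₁ x y, x) ∉
                Set.Icc (-(2 * Real.sqrt A₁)) (2 * Real.sqrt A₁) ×ˢ
                  Set.Icc (-(2 * Real.sqrt A₁)) (2 * Real.sqrt A₁) := by
  have hB0 := abs_nonneg B
  refine ⟨(4 * (1 + |B| + β)) ^ 2, by positivity, ?_⟩
  intro h hh A₁ hA x y hxy hx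
  have hA0 : 0 ≤ A₁ := (sq_nonneg _).trans hA
  have hs : 4 * (1 + |B| + β) ≤ √A₁ := Real.le_sqrt_of_sq_le hA
  have hsq : √A₁ ^ 2 = A₁ := Real.sq_sqrt hA0
  obtain ⟨-, hy⟩ := Set.mem_prod.mp hxy
  have hy' : |y| ≤ 2 * √A₁ := abs_le.mpr hy
  have hBy : -(|B| * (2 * √A₁)) ≤ B * y := by
    have h₁ : |B * y| ≤ |B| * (2 * √A₁) := by
      rw [abs_mul]
      gcongr
    exact (abs_le.mp h₁).1
  have hx2 : x ^ 2 ≤ (√A₁ / 2) ^ 2 := by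
    rw [← sq_abs x]
    gcongr
  have hpert : -(β * (1 + √A₁ / 2)) ≤ h A₁ x y := by
    have h₁ : |h A₁ x y| ≤ β * (1 + √A₁ / 2) := (hh A₁ x y).trans (by gcongr)
    exact (abs_le.mp h₁).1
  have hs1 : 1 ≤ √A₁ := by linarith
  have key : 2 * √A₁ < A₁ + B * y - x ^ 2 + h A₁ x y := by
    have h₁ : 4 * (1 + |B| + β) * √A₁ ≤ √A₁ * √A₁ := by gcongr
    have h₂ : β * 1 ≤ β * √A₁ := by gcongr
    have h₃ : 0 ≤ |B| * √A₁ := by positivity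
    nlinarith
  exact ⟨key, fun hmem => absurd (Set.mem_prod.mp hmem).1.2 (not_le.mpr key)⟩
end

section
/- Let B ≠ 0 and β > 0 be real constants, and let g : ℝ² → ℝ be a C^∞ function satisfying |g(A,x)| ≤ β(1+|x|) and |∂g/∂x(A,x)| ≤ β for all (A,x). Define F₁(A,x,y) = A + B·y − x² + g(A,x). There exists A* > 0, depending only on β and |B|, such that for every A₁ ≥ A*, setting s = √A₁, Q = 2s and L = [−Q,Q], the following holds for every y ∈ L: F₁(A₁, s/2, y) > Q and F₁(A₁, 2s, y) < −Q, and consequently the image of the interval J₂ = [s/2, 2s] under x ↦ F₁(A₁,x,y) contains L; similarly F₁(A₁, −s/2, y) > Q and F₁(A₁, −2s, y) < −Q, so the image of J₁ = [−2s,−s/2] under x ↦ F₁(A₁,x,y) contains L. -/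
/-- For `s ≥ 4 (|b| + β + 1)` and `|y| ≤ 2 s`, a value of size at most `β (1 + s / 2)` added to
`s ^ 2 + b y - (s / 2) ^ 2` leaves it above `2 s`. -/
theorem henon_inner_endpoint_gt {b β s y v : ℝ} (hβ : 0 < β) (hs : 4 * (|b| + β + 1) ≤ s)
    (hy : |y| ≤ 2 * s) (hv : |v| ≤ β * (1 + s / 2)) :
    2 * s < s ^ 2 + b * y - (s / 2) ^ 2 + v := by
  have hb := abs_nonneg b
  have hby : |b * y| ≤ |b| * (2 * s) := by
    rw [abs_mul]
    exact mul_le_mul_of_nonneg_left hy hb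
  have h₁ := (abs_le.1 hby).1
  have h₂ := (abs_le.1 hv).1
  have hs₁ : 1 ≤ s := by linarith
  have h₃ := mul_le_mul_of_nonneg_right hs (by linarith : 0 ≤ s)
  have h₄ := mul_le_mul_of_nonneg_left hs₁ hβ.le
  nlinarith [mul_nonneg hb (by linarith : 0 ≤ s)]

/-- For `s ≥ 4 (|b| + β + 1)` and `|y| ≤ 2 s`, a value of size at most `β (1 + 2 s)` added to
`s ^ 2 + b y - (2 s) ^ 2` leaves it below `-2 s`. -/
theorem henon_outer_endpoint_lt {b β s y v : ℝ} (hβ : 0 < β) (hs : 4 * (|b| + β + 1) ≤ s)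
    (hy : |y| ≤ 2 * s) (hv : |v| ≤ β * (1 + 2 * s)) :
    s ^ 2 + b * y - (2 * s) ^ 2 + v < -(2 * s) := by
  have hb := abs_nonneg b
  have hby : |b * y| ≤ |b| * (2 * s) := by
    rw [abs_mul]
    exact mul_le_mul_of_nonneg_left hy hb
  have h₁ := (abs_le.1 hby).2
  have h₂ := (abs_le.1 hv).2
  have hs₁ : 1 ≤ s := by linarith
  have h₃ := mul_le_mul_of_nonneg_right hs (by linarith : 0 ≤ s)
  have h₄ := mul_le_mul_of_nonneg_left hs₁ hβ.le
  nlinarith [mul_nonneg hb (by linarith : 0 ≤ s)]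


/-- For sufficiently large `A₁` (depending only on `β` and `|B|`),
for each `y ∈ L = [−Q,Q]` the map `x ↦ F₁(A₁,x,y)` sends the endpoints of
`J₂ = [s/2,2s]` (resp. `J₁ = [−2s,−s/2]`) outside `L` on opposite sides, and its
image of `J₂` (resp. `J₁`) contains all of `L`. -/
theorem perturbed_henon_stretches_across
    (B β : ℝ) (hB : B ≠ 0) (hβ : 0 < β) :
    ∃ Astar : ℝ, 0 < Astar ∧
      ∀ g gx : ℝ → ℝ → ℝ,
        ContDiff ℝ (⊤ : ℕ∞) (fun p : ℝ × ℝ => g p.1 p.2) →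
        (∀ A x : ℝ, |g A x| ≤ β * (1 + |x|)) →
        (∀ A x : ℝ, HasDerivAt (g A) (gx A x) x) →
        (∀ A x : ℝ, |gx A x| ≤ β) →
        ∀ A₁ : ℝ, Astar ≤ A₁ →
          ∀ y : ℝ, y ∈ Set.Icc (-(2 * Real.sqrt A₁)) (2 * Real.sqrt A₁) →
            (2 * Real.sqrt A₁ <
                A₁ + B * y - (Real.sqrt A₁ / 2) ^ 2 + g A₁ (Real.sqrt A₁ / 2)) ∧
            (A₁ + B * y - (2 * Real.sqrt A₁) ^ 2 + g A₁ (2 * Real.sqrt A₁) <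
                -(2 * Real.sqrt A₁)) ∧
            Set.Icc (-(2 * Real.sqrt A₁)) (2 * Real.sqrt A₁) ⊆
              (fun x : ℝ => A₁ + B * y - x ^ 2 + g A₁ x) ''
                Set.Icc (Real.sqrt A₁ / 2) (2 * Real.sqrt A₁) ∧
            (2 * Real.sqrt A₁ <
                A₁ + B * y - (-(Real.sqrt A₁ / 2)) ^ 2 + g A₁ (-(Real.sqrt A₁ / 2))) ∧
            (A₁ + B * y - (-(2 * Real.sqrt A₁)) ^ 2 + g A₁ (-(2 * Real.sqrt A₁)) <
                -(2 * Real.sqrt A₁)) ∧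
            Set.Icc (-(2 * Real.sqrt A₁)) (2 * Real.sqrt A₁) ⊆
              (fun x : ℝ => A₁ + B * y - x ^ 2 + g A₁ x) ''
                Set.Icc (-(2 * Real.sqrt A₁)) (-(Real.sqrt A₁ / 2)) := by
  have hK : 0 < 4 * (|B| + β + 1) := by positivity
  refine ⟨(4 * (|B| + β + 1)) ^ 2, by positivity, ?_⟩
  intro g gx _ hg hgx _ A hA y hy
  have hs : 4 * (|B| + β + 1) ≤ √A := Real.le_sqrt_of_sq_le hA
  have hsA : √A ^ 2 = A := Real.sq_sqrt ((sq_nonneg _).trans hA)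
  have hs₀ : 0 < √A := hK.trans_le hs
  have hy' : |y| ≤ 2 * √A := abs_le.2 hy
  have hcont : Continuous fun x : ℝ => A + B * y - x ^ 2 + g A x := by
    have : Continuous (g A) := continuous_iff_continuousAt.2 fun x => (hgx A x).continuousAt
    fun_prop
  have inner : ∀ x : ℝ, |x| = √A / 2 → 2 * √A < A + B * y - x ^ 2 + g A x := fun x hx => by
    have h := henon_inner_endpoint_gt hβ hs hy' (hx ▸ hg A x)
    rwa [← hx, sq_abs, hsA] at h
  have outer : ∀ x : ℝ, |x| = 2 * √A → A + B * y - x ^ 2 + g A x < -(2 * √A) := fun x hx => by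
    have h := henon_outer_endpoint_lt hβ hs hy' (hx ▸ hg A x)
    rwa [hsA, ← hx, sq_abs, hx] at h
  have i₁ := inner (√A / 2) (abs_of_pos (by positivity))
  have o₁ := outer (2 * √A) (abs_of_pos (by positivity))
  have i₂ := inner (-(√A / 2)) (by rw [abs_neg, abs_of_pos (by positivity)])
  have o₂ := outer (-(2 * √A)) (by rw [abs_neg, abs_of_pos (by positivity)])
  refine ⟨i₁, o₁, ?_, i₂, o₂, ?_⟩
  · exact (Set.Icc_subset_Icc o₁.le i₁.le).trans
      (intermediate_value_Icc' (by linarith) hcont.continuousOn)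
  · exact (Set.Icc_subset_Icc o₂.le i₂.le).trans
      (intermediate_value_Icc (by linarith) hcont.continuousOn)
end

section
/- Let a, B, β be real numbers and A₁ ≥ 0 with |a| ≥ 2√A₁ − β, and set N = √A₁ − β − |B|. Then for every vector (ξ, η) ∈ ℝ² with |η| ≤ |ξ| (i.e. (ξ,η) in the unstable cone S₁⁺), the image (ξ₁, η₁) = (a·ξ + B·η, ξ) under the matrix [[a, B], [1, 0]] satisfies |ξ₁| ≥ N·|η₁|. In particular, if N > 1 then the matrix [[a, B], [1, 0]] maps the cone S₁⁺ = {(ξ,η) : |ξ| ≥ |η|} into the cone S_N⁺ = {(ξ,η) : |ξ| ≥ N|η|}, expanding the first coordinate by the factor N. -/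
/-- The Jacobian matrix `[[a, B], [1, 0]]` maps the unstable cone
`S₁⁺ = {|ξ| ≥ |η|}` into the cone `S_N⁺ = {|ξ| ≥ N|η|}` with expansion factor
`N = √A₁ − β − |B|`, provided `|a| ≥ 2√A₁ − β`. -/
theorem henon_jacobian_unstable_cone
    (a B β A₁ : ℝ) (hA₁ : 0 ≤ A₁)
    (ha : 2 * Real.sqrt A₁ - β ≤ |a|)
    (N : ℝ) (hN : N = Real.sqrt A₁ - β - |B|)
    (Splus : ℝ → Set (ℝ × ℝ))
    (hS : ∀ c : ℝ, Splus c = {v : ℝ × ℝ | c * |v.2| ≤ |v.1|}) :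
    (∀ ξ η : ℝ, |η| ≤ |ξ| → N * |ξ| ≤ |a * ξ + B * η|) ∧
    (1 < N → ∀ v : ℝ × ℝ, v ∈ Splus 1 →
      (a * v.1 + B * v.2, v.1) ∈ Splus N ∧ N * |v.1| ≤ |a * v.1 + B * v.2|) := by
  have expand : ∀ ξ η : ℝ, |η| ≤ |ξ| → N * |ξ| ≤ |a * ξ + B * η| := by
    intro ξ η h
    have hcoeff : N ≤ |a| - |B| := by linarith [Real.sqrt_nonneg A₁]
    calc N * |ξ| ≤ (|a| - |B|) * |ξ| := by gcongr
      _ = |a| * |ξ| - |B| * |ξ| := sub_mul _ _ _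
      _ ≤ |a| * |ξ| - |B| * |η| := by gcongr
      _ = |a * ξ| - |B * η| := by rw [abs_mul, abs_mul]
      _ ≤ |a * ξ + B * η| := by
        simpa using abs_sub_abs_le_abs_sub (a * ξ) (-(B * η))
  refine ⟨expand, fun _ v hv => ?_⟩
  rw [hS, Set.mem_ofPred_eq, one_mul] at hv
  have h := expand v.1 v.2 hv
  exact ⟨by rw [hS]; exact h, h⟩
end

section
/- Let a, B, β be real numbers with B ≠ 0, and let A₁ ≥ 1 with |a| ≥ 2√A₁ − β. Set N₁ = (√A₁ − β − |B|)/|B|. Then for every vector (ξ, η) ∈ ℝ² with |ξ| ≤ |η| (i.e. (ξ,η) in the stable cone S₁⁻), the preimage (ξ₋₁, η₋₁) = (η, (ξ − a·η)/B) of (ξ,η) under the matrix [[a, B], [1, 0]] satisfies |η₋₁| ≥ N₁·|ξ₋₁|. In particular, if N₁ > 1 then the inverse of the matrix [[a, B], [1, 0]] maps the cone S₁⁻ = {(ξ,η) : |ξ| ≤ |η|} into the cone S_{N₁}⁻ = {(ξ,η) : N₁|ξ| ≤ |η|}. -/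
/-- The inverse of the Jacobian matrix `[[a, B], [1, 0]]` maps the
stable cone `S₁⁻ = {|ξ| ≤ |η|}` into the cone `S_{N₁}⁻ = {N₁|ξ| ≤ |η|}` with
`N₁ = (√A₁ − β − |B|)/|B|`, provided `|a| ≥ 2√A₁ − β`. -/
theorem henon_jacobian_stable_cone
    (a B β A₁ : ℝ) (hB : B ≠ 0) (hA₁ : 1 ≤ A₁)
    (ha : 2 * Real.sqrt A₁ - β ≤ |a|)
    (N₁ : ℝ) (hN₁ : N₁ = (Real.sqrt A₁ - β - |B|) / |B|)
    (Sminus : ℝ → Set (ℝ × ℝ))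
    (hS : ∀ c : ℝ, Sminus c = {v : ℝ × ℝ | c * |v.1| ≤ |v.2|}) :
    (∀ ξ η : ℝ, |ξ| ≤ |η| →
      -- `(η, (ξ − a·η)/B)` is indeed the preimage of `(ξ, η)` under `[[a,B],[1,0]]`
      (a * η + B * ((ξ - a * η) / B), η) = (ξ, η) ∧
      N₁ * |η| ≤ |(ξ - a * η) / B|) ∧
    (1 < N₁ → ∀ v : ℝ × ℝ, v ∈ Sminus 1 →
      (v.2, (v.1 - a * v.2) / B) ∈ Sminus N₁) := by
  have hBpos : 0 < |B| := abs_pos.mpr hB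
  have hsqrt : 1 ≤ Real.sqrt A₁ := Real.one_le_sqrt.mpr hA₁
  have expansion : ∀ ξ η : ℝ, |ξ| ≤ |η| → N₁ * |η| ≤ |(ξ - a * η) / B| := by
    intro ξ η h
    rw [hN₁, abs_div, div_mul_eq_mul_div]
    gcongr
    have htri : |a| * |η| - |ξ| ≤ |ξ - a * η| := by
      rw [← abs_mul, abs_sub_comm ξ]
      exact abs_sub_abs_le_abs_sub _ _
    have hcoef : Real.sqrt A₁ - β - |B| ≤ |a| - 1 := by linarith
    have hmul := mul_le_mul_of_nonneg_right hcoef (abs_nonneg η)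
    linarith
  refine ⟨fun ξ η h => ⟨?_, expansion ξ η h⟩, fun _ v hv => ?_⟩
  · rw [mul_div_cancel₀ _ hB, add_sub_cancel]
  · rw [hS, Set.mem_ofPred_eq] at hv ⊢
    exact expansion v.1 v.2 (by rwa [one_mul] at hv)
end

section
/- Consider the full one-sided shift on two symbols, σ : {0,1}^ℕ → {0,1}^ℕ, (σx)(n) = x(n+1). For a sequence x of least period k (i.e. σ^k x = x and σ^j x ≠ x for 1 ≤ j < k), call its orbit {x, σx, …, σ^{k−1}x} even if the number of indices 0 ≤ i < k with x(i) = 1 is even (this count is the same for every representative of the orbit). If k is odd, then the number of even orbits of least period exactly k equals the number of non-even (odd) orbits of least period exactly k; equivalently, for odd k exactly half of the orbits of least period k are even. -/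
/-- The full one-sided shift on two symbols. -/
def twoShift : (ℕ → Bool) → (ℕ → Bool) := fun x n => x (n + 1)

/-- `x` has least period exactly `k` under the shift. -/
def ShiftLeastPeriod (k : ℕ) (x : ℕ → Bool) : Prop :=
  twoShift^[k] x = x ∧ ∀ j : ℕ, 0 < j → j < k → twoShift^[j] x ≠ x

/-- The (period-`k`) orbit `{x, σx, …, σ^{k−1}x}` of `x` under the shift. -/
def shiftOrbit (k : ℕ) (x : ℕ → Bool) : Set (ℕ → Bool) :=
  {y | ∃ i : ℕ, i < k ∧ y = twoShift^[i] x}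

/-- `x` is even over one period of length `k`: the number of indices `i < k`
with `x i = 1` (i.e. `true`) is even. -/
def EvenSymbolSeq (k : ℕ) (x : ℕ → Bool) : Prop :=
  Even ((Finset.range k).filter (fun i => x i = true)).card

/-- Symbolwise complementation of a binary sequence. -/
def complementSeq (x : ℕ → Bool) : ℕ → Bool := fun n => !x n

theorem complementSeq_involutive : Function.Involutive complementSeq := fun x => by
  funext n
  simp [complementSeq]

theorem twoShift_iterate_complementSeq (j : ℕ) (x : ℕ → Bool) :
    twoShift^[j] (complementSeq x) = complementSeq (twoShift^[j] x) :=
  ((show Function.Commute twoShift complementSeq from fun _ => rfl).iterate_left j) x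

theorem ShiftLeastPeriod.complementSeq {k : ℕ} {x : ℕ → Bool} (hx : ShiftLeastPeriod k x) :
    ShiftLeastPeriod k (complementSeq x) := by
  simpa only [ShiftLeastPeriod, twoShift_iterate_complementSeq, ne_eq,
    complementSeq_involutive.injective.eq_iff] using hx

theorem shiftOrbit_complementSeq (k : ℕ) (x : ℕ → Bool) :
    shiftOrbit k (complementSeq x) = complementSeq '' shiftOrbit k x := by
  ext y
  simp only [shiftOrbit, twoShift_iterate_complementSeq, Set.mem_ofPred_eq, Set.mem_image]
  constructor
  · rintro ⟨i, hi, rfl⟩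
    exact ⟨_, ⟨i, hi, rfl⟩, rfl⟩
  · rintro ⟨_, ⟨i, hi, rfl⟩, rfl⟩
    exact ⟨i, hi, rfl⟩

theorem evenSymbolSeq_complementSeq_iff {k : ℕ} (hk : Odd k) (x : ℕ → Bool) :
    EvenSymbolSeq k (complementSeq x) ↔ ¬ EvenSymbolSeq k x := by
  have hcard := Finset.card_filter_add_card_filter_not (s := Finset.range k) (fun i => x i = true)
  rw [Finset.card_range] at hcard
  simp only [EvenSymbolSeq, complementSeq, Bool.not_eq_true', Bool.not_eq_true] at hcard ⊢
  rw [← hcard, Nat.odd_add'] at hk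
  rw [Nat.not_even_iff_odd, ← Nat.not_odd_iff_even, hk, Nat.not_even_iff_odd]

/-- For odd `k`, the number of even orbits of least period `k`
of the full two-shift equals the number of non-even (odd) orbits of least
period `k`. -/
theorem even_orbits_eq_odd_orbits_of_odd_period
    (k : ℕ) (hk : Odd k) :
    Set.ncard {O : Set (ℕ → Bool) |
        ∃ x : ℕ → Bool, ShiftLeastPeriod k x ∧ EvenSymbolSeq k x ∧ O = shiftOrbit k x}
      =
    Set.ncard {O : Set (ℕ → Bool) |
        ∃ x : ℕ → Bool, ShiftLeastPeriod k x ∧ ¬ EvenSymbolSeq k x ∧ O = shiftOrbit k x} := by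
  rw [← Set.ncard_image_of_injective _ complementSeq_involutive.injective.image_injective]
  congr 1
  ext O
  constructor
  · rintro ⟨_, ⟨x, hx, hev, rfl⟩, rfl⟩
    refine ⟨complementSeq x, hx.complementSeq, ?_, (shiftOrbit_complementSeq k x).symm⟩
    rwa [evenSymbolSeq_complementSeq_iff hk, not_not]
  · rintro ⟨x, hx, hodd, rfl⟩
    refine ⟨_, ⟨complementSeq x, hx.complementSeq,
      (evenSymbolSeq_complementSeq_iff hk x).2 hodd, rfl⟩, ?_⟩
    rw [← shiftOrbit_complementSeq, complementSeq_involutive x]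
end

section
/- Consider the full one-sided shift on two symbols, σ : {0,1}^ℕ → {0,1}^ℕ, (σx)(n) = x(n+1). If k is an odd prime, then the number of even orbits of least period exactly k is (2^k − 2)/(2k). -/
open Function

theorem twoShift_iterate_apply (j : ℕ) (x : ℕ → Bool) (n : ℕ) :
    twoShift^[j] x n = x (n + j) := by
  induction j generalizing x with
  | zero => rfl
  | succ j ih => rw [iterate_succ_apply, ih]; rfl

theorem isPeriodicPt_twoShift_iff {k : ℕ} {x : ℕ → Bool} :
    IsPeriodicPt twoShift k x ↔ Periodic x k := by
  refine ⟨fun h n => ?_, fun h => funext fun n => ?_⟩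
  · rw [← twoShift_iterate_apply k x n, h.eq]
  · rw [twoShift_iterate_apply, h]

theorem shiftLeastPeriod_iff_minimalPeriod_eq {k : ℕ} (hk : 0 < k) {x : ℕ → Bool} :
    ShiftLeastPeriod k x ↔ minimalPeriod twoShift x = k := by
  constructor
  · rintro ⟨h, h'⟩
    have hp : IsPeriodicPt twoShift k x := h
    refine (hp.minimalPeriod_le hk).antisymm (not_lt.1 fun hlt => ?_)
    exact h' _ (hp.minimalPeriod_pos hk) hlt (isPeriodicPt_minimalPeriod twoShift x)
  · rintro rfl
    exact ⟨isPeriodicPt_minimalPeriod twoShift x, fun j hj hlt =>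
      not_isPeriodicPt_of_pos_of_lt_minimalPeriod hj.ne' hlt⟩

theorem shiftLeastPeriod_prime_iff {k : ℕ} (hk : k.Prime) {x : ℕ → Bool} :
    ShiftLeastPeriod k x ↔ Periodic x k ∧ ∀ b, x ≠ fun _ => b := by
  have : Fact k.Prime := ⟨hk⟩
  rw [← isPeriodicPt_twoShift_iff]
  constructor
  · refine fun h => ⟨h.1, ?_⟩
    rintro b rfl
    exact h.2 1 one_pos hk.one_lt rfl
  · rintro ⟨hp, hx⟩
    rw [shiftLeastPeriod_iff_minimalPeriod_eq hk.pos]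
    refine minimalPeriod_eq_prime hp fun hfix => hx (x 0) (funext fun n => ?_)
    have h := congrFun (hfix.iterate n).eq 0
    rwa [twoShift_iterate_apply, zero_add] at h

theorem ShiftLeastPeriod.iterate {k : ℕ} (hk : 0 < k) {x : ℕ → Bool}
    (h : ShiftLeastPeriod k x) (i : ℕ) : ShiftLeastPeriod k (twoShift^[i] x) := by
  have hp : x ∈ periodicPts twoShift := ⟨k, hk, h.1⟩
  rw [shiftLeastPeriod_iff_minimalPeriod_eq hk] at h ⊢
  rw [minimalPeriod_apply_iterate hp, h]

theorem card_filter_twoShift {k : ℕ} {x : ℕ → Bool} (h : Periodic x k) :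
    ((Finset.range k).filter (fun i => twoShift x i = true)).card =
      ((Finset.range k).filter (fun i => x i = true)).card := by
  rw [Finset.card_filter, Finset.card_filter]
  have h₁ := Finset.sum_range_succ (fun i => if x i = true then 1 else 0) k
  have h₂ := Finset.sum_range_succ' (fun i => if x i = true then 1 else 0) k
  rw [h.eq] at h₁
  exact Nat.add_right_cancel (h₂.symm.trans h₁)

theorem EvenSymbolSeq.iterate {k : ℕ} {x : ℕ → Bool} (hp : IsPeriodicPt twoShift k x)
    (h : EvenSymbolSeq k x) (i : ℕ) : EvenSymbolSeq k (twoShift^[i] x) := by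
  induction i with
  | zero => exact h
  | succ i ih =>
    rw [iterate_succ_apply']
    unfold EvenSymbolSeq
    rwa [card_filter_twoShift (isPeriodicPt_twoShift_iff.1 (hp.apply_iterate i))]

theorem evenSymbolSeq_not_iff {k : ℕ} (hk : Odd k) (x : ℕ → Bool) :
    EvenSymbolSeq k (fun n => !x n) ↔ ¬ EvenSymbolSeq k x := by
  have h := Finset.card_filter_add_card_filter_not (s := Finset.range k) (fun i => x i = true)
  rw [Finset.card_range] at h
  simp only [EvenSymbolSeq, Bool.not_eq_true'] at *
  simp only [Bool.not_eq_true] at h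
  rw [← h] at hk
  grind

theorem mem_shiftOrbit_iff {k : ℕ} (hk : 0 < k) {x y : ℕ → Bool}
    (h : IsPeriodicPt twoShift k x) : y ∈ shiftOrbit k x ↔ ∃ n, y = twoShift^[n] x :=
  ⟨fun ⟨i, _, hi⟩ => ⟨i, hi⟩, fun ⟨n, hn⟩ =>
    ⟨n % k, Nat.mod_lt n hk, by rw [h.iterate_mod_apply, hn]⟩⟩

theorem shiftOrbit_iterate {k : ℕ} (hk : 0 < k) {x : ℕ → Bool}
    (h : IsPeriodicPt twoShift k x) {i : ℕ} (hi : i < k) :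
    shiftOrbit k (twoShift^[i] x) = shiftOrbit k x := by
  ext y
  rw [mem_shiftOrbit_iff hk h, mem_shiftOrbit_iff hk (h.apply_iterate i)]
  constructor
  · rintro ⟨n, rfl⟩
    exact ⟨n + i, (iterate_add_apply _ _ _ _).symm⟩
  · rintro ⟨n, rfl⟩
    refine ⟨n + (k - i), ?_⟩
    rw [← iterate_add_apply, add_assoc, Nat.sub_add_cancel hi.le, iterate_add_apply, h.eq]

theorem ncard_shiftOrbit {k : ℕ} (hk : 0 < k) {x : ℕ → Bool} (h : ShiftLeastPeriod k x) :
    (shiftOrbit k x).ncard = k := by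
  have himage : shiftOrbit k x = (fun i => twoShift^[i] x) '' Set.Iio k := by
    ext y
    simp [shiftOrbit, eq_comm]
  have hinj := iterate_injOn_Iio_minimalPeriod (f := twoShift) (x := x)
  rw [(shiftLeastPeriod_iff_minimalPeriod_eq hk).1 h] at hinj
  rw [himage, hinj.ncard_image, ← Finset.coe_Iio, Set.ncard_coe_finset, Nat.card_Iio]

/-- Sequences of period `k` correspond to words of length `k`. -/
def periodicEquivWord (k : ℕ) [NeZero k] : {x : ℕ → Bool // Periodic x k} ≃ (Fin k → Bool) where
  toFun x i := x.1 i
  invFun f := ⟨fun n => f (Fin.ofNat k n), fun n => congrArg f (by ext; simp)⟩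
  left_inv x := Subtype.ext (funext fun n => x.2.map_mod_nat n)
  right_inv f := funext fun i => congrArg f (by simp)

theorem ncard_periodic {k : ℕ} (hk : 0 < k) : {x : ℕ → Bool | Periodic x k}.ncard = 2 ^ k := by
  have : NeZero k := ⟨hk.ne'⟩
  rw [← Nat.card_coe_set_eq]
  exact (Nat.card_congr (periodicEquivWord k)).trans (by simp)

theorem finite_periodic {k : ℕ} (hk : 0 < k) : {x : ℕ → Bool | Periodic x k}.Finite :=
  Set.finite_of_ncard_pos (by rw [ncard_periodic hk]; positivity)

theorem finite_shiftLeastPeriod {k : ℕ} (hk : 0 < k) : {x | ShiftLeastPeriod k x}.Finite :=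
  (finite_periodic hk).subset fun _ hx => isPeriodicPt_twoShift_iff.1 hx.1

theorem ncard_shiftLeastPeriod {k : ℕ} (hk : k.Prime) :
    {x | ShiftLeastPeriod k x}.ncard = 2 ^ k - 2 := by
  have hset : {x | ShiftLeastPeriod k x} =
      {x : ℕ → Bool | Periodic x k} \ {fun _ => true, fun _ => false} := by
    ext x
    simp [shiftLeastPeriod_prime_iff hk, and_comm]
  have hpair : ({fun _ => true, fun _ => false} : Set (ℕ → Bool)).ncard = 2 :=
    Set.ncard_pair fun h => Bool.noConfusion (congrFun h 0)
  rw [hset, Set.ncard_sdiff, ncard_periodic hk.pos, hpair]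
  rintro x (rfl | rfl) n <;> rfl

theorem two_mul_ncard_even {k : ℕ} (hk : k.Prime) (hodd : Odd k) :
    2 * {x | ShiftLeastPeriod k x ∧ EvenSymbolSeq k x}.ncard = 2 ^ k - 2 := by
  have hinv : Involutive fun (x : ℕ → Bool) n => !x n := fun x => by simp
  have himage : {x | ShiftLeastPeriod k x ∧ ¬ EvenSymbolSeq k x} =
      (fun (x : ℕ → Bool) n => !x n) '' {x | ShiftLeastPeriod k x ∧ EvenSymbolSeq k x} := by
    rw [hinv.image_eq_preimage_symm]
    ext x
    simp only [Set.mem_ofPred_eq, Set.mem_preimage, evenSymbolSeq_not_iff hodd,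
      shiftLeastPeriod_prime_iff hk]
    simp [Periodic, funext_iff, and_comm]
  have hsplit := Set.ncard_inter_add_ncard_sdiff_eq_ncard {x | ShiftLeastPeriod k x}
    {x | EvenSymbolSeq k x} (finite_shiftLeastPeriod hk.pos)
  have hdiff : {x | ShiftLeastPeriod k x} \ {x | EvenSymbolSeq k x} =
    {x | ShiftLeastPeriod k x ∧ ¬ EvenSymbolSeq k x} := rfl
  rw [ncard_shiftLeastPeriod hk, hdiff, himage,
    Set.ncard_image_of_injective _ hinv.injective] at hsplit
  rw [two_mul]
  exact hsplit

theorem ncard_even_eq_mul_ncard_orbits {k : ℕ} (hk : 0 < k) :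
    {x | ShiftLeastPeriod k x ∧ EvenSymbolSeq k x}.ncard =
      (shiftOrbit k '' {x | ShiftLeastPeriod k x ∧ EvenSymbolSeq k x}).ncard * k := by
  classical
  have hfin : {x | ShiftLeastPeriod k x ∧ EvenSymbolSeq k x}.Finite :=
    (finite_shiftLeastPeriod hk).subset fun _ hx => hx.1
  obtain ⟨s, hs⟩ := hfin.exists_finset_coe
  rw [← hs, ← Finset.coe_image, Set.ncard_coe_finset, Set.ncard_coe_finset,
    Finset.card_eq_sum_card_image (shiftOrbit k) s]
  refine Finset.sum_const_nat fun O hO => ?_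
  obtain ⟨x, hxs, rfl⟩ := Finset.mem_image.1 hO
  have hmem (y) : y ∈ s ↔ ShiftLeastPeriod k y ∧ EvenSymbolSeq k y := by
    rw [← Finset.mem_coe, hs, Set.mem_ofPred_eq]
  have hx := (hmem x).1 hxs
  rw [← Set.ncard_coe_finset]
  convert ncard_shiftOrbit hk hx.1
  ext y
  rw [Finset.mem_coe, Finset.mem_filter, hmem]
  constructor
  · rintro ⟨-, hy⟩
    rw [← hy]
    exact ⟨0, hk, rfl⟩
  · rintro ⟨i, hi, rfl⟩
    exact ⟨⟨hx.1.iterate hk i, hx.2.iterate hx.1.1 i⟩, shiftOrbit_iterate hk hx.1.1 hi⟩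

/-- For an odd prime `k`, the number of even orbits of least
period exactly `k` of the full two-shift is `(2^k − 2)/(2k)`. -/
theorem even_orbit_count_of_odd_prime
    (k : ℕ) (hk : Nat.Prime k) (hodd : Odd k) :
    Set.ncard {O : Set (ℕ → Bool) |
        ∃ x : ℕ → Bool, ShiftLeastPeriod k x ∧ EvenSymbolSeq k x ∧ O = shiftOrbit k x}
      = (2 ^ k - 2) / (2 * k) := by
  have hset : {O : Set (ℕ → Bool) |
      ∃ x : ℕ → Bool, ShiftLeastPeriod k x ∧ EvenSymbolSeq k x ∧ O = shiftOrbit k x} =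
      shiftOrbit k '' {x | ShiftLeastPeriod k x ∧ EvenSymbolSeq k x} := by
    ext O
    simp [and_assoc, eq_comm]
  rw [hset, ← two_mul_ncard_even hk hodd, ncard_even_eq_mul_ncard_orbits hk.pos, mul_left_comm,
    mul_comm, Nat.div_eq_of_eq_mul_left (Nat.mul_pos two_pos hk.pos) (mul_comm _ _)]
end
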